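/- arXiv:2510.14415 — 3 statements merged into one kernel-verified Lean document; each statement's English description precedes it below -/
import Mathlib

section
/- Let 𝒳 be a nonempty finite set, and for each x ∈ 𝒳 let π*_x be a probability vector on 𝒢 and m(·,x) : 𝒢 → ℝ a function. For any q ∈ [1,∞) and δ > 0, the linear-program value κ̄_{δ,q} := ∑_{x∈𝒳} max_{Γ ∈ F(π*_x, δ, q)} ∑_{u,v∈𝒢} Γ(u,v) m(v,x) satisfies the strong duality identity κ̄_{δ,q} = ∑_{x∈𝒳} min_{λ ≥ 0} [ λ δ^q + ∑_{u∈𝒢} ( max_{v∈𝒢} ( m(v,x) − λ|u−v|^q ) ) π*_x(u) ], where for each x both the inner maximum over Γ and the minimum over λ ≥ 0 are attained. (Proposition 1 of the paper.) -/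
open Finset

/-- Lagrange multiplier rule for one linear inequality constraint over a convex set, under
Slater's condition. -/
theorem exists_lagrange_multiplier {E : Type*} [AddCommGroup E] [Module ℝ E] {K : Set E}
    (hK : Convex ℝ K) (f g : E →ₗ[ℝ] ℝ) {p b : ℝ}
    (hp : ∀ z ∈ K, g z ≤ b → f z ≤ p) {z₀ : E} (hz₀ : z₀ ∈ K) (hs : g z₀ < b) :
    ∃ lam : ℝ, 0 ≤ lam ∧ ∀ z ∈ K, f z + lam * (b - g z) ≤ p := by
  let T : Set (ℝ × ℝ) := {y | ∃ z ∈ K, y = (f z - p, b - g z)}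
  have hT : Convex ℝ T := by
    rintro _ ⟨z, hz, rfl⟩ _ ⟨w, hw, rfl⟩ s t hs0 ht0 hst
    refine ⟨s • z + t • w, hK hz hw hs0 ht0 hst, ?_⟩
    ext
    · simp
      linear_combination -p * hst
    · simp
      linear_combination b * hst
  have hdisj : Disjoint (Set.Ioi (0 : ℝ) ×ˢ Set.Ioi (0 : ℝ)) T := by
    rw [Set.disjoint_left]
    rintro _ ⟨h1, h2⟩ ⟨z, hz, rfl⟩
    have h1' : 0 < f z - p := h1
    have h2' : 0 < b - g z := h2
    linarith [hp z hz (by linarith)]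
  obtain ⟨φ, w, hQ, hTw⟩ := geometric_hahn_banach_open
    ((convex_Ioi (0 : ℝ)).prod (convex_Ioi (0 : ℝ))) (isOpen_Ioi.prod isOpen_Ioi) hT hdisj
  have hφ : ∀ s t : ℝ, φ (s, t) = s * φ (1, 0) + t * φ (0, 1) := fun s t => by
    have : ((s, t) : ℝ × ℝ) = s • (1, 0) + t • (0, 1) := by ext <;> simp
    rw [this, map_add, map_smul, map_smul, smul_eq_mul, smul_eq_mul]
  set α := φ (1, 0)
  set β := φ (0, 1)
  have hQ' : ∀ s t : ℝ, 0 < s → 0 < t → s * α + t * β < w := fun s t h1 h2 => by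
    rw [← hφ]
    exact hQ _ ⟨h1, h2⟩
  have hT' : ∀ z ∈ K, w ≤ (f z - p) * α + (b - g z) * β := fun z hz => by
    rw [← hφ]
    exact hTw _ ⟨z, hz, rfl⟩
  have hα : α ≤ 0 := by
    by_contra! h
    have := hQ' ((|w| + |β|) / α + 1) 1 (by positivity) one_pos
    rw [add_mul, div_mul_cancel₀ _ h.ne'] at this
    linarith [le_abs_self w, neg_abs_le β]
  have hβ : β ≤ 0 := by
    by_contra! h
    have := hQ' 1 ((|w| + |α|) / β + 1) one_pos (by positivity)
    rw [add_mul, div_mul_cancel₀ _ h.ne'] at this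
    linarith [le_abs_self w, neg_abs_le α]
  have hw : 0 ≤ w := by
    by_contra! h
    have hd : α + β - 1 < 0 := by linarith
    have hε := div_pos_of_neg_of_neg h hd
    have := hQ' _ _ hε hε
    have h3 := div_mul_cancel₀ w hd.ne
    nlinarith
  have hα' : α < 0 := by
    refine lt_of_le_of_ne hα fun h => ?_
    have h1 := hQ' 1 1 one_pos one_pos
    have h2 := hT' z₀ hz₀
    have hβ' : β < 0 := by
      refine lt_of_le_of_ne hβ fun h' => ?_
      rw [h, h'] at h1 h2
      linarith
    rw [h] at h2
    nlinarith
  refine ⟨β / α, div_nonneg_of_nonpos hβ hα, fun z hz => ?_⟩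
  have h1 := hT' z hz
  have h2 : β / α * α = β := div_mul_cancel₀ _ hα'.ne
  by_contra! h
  have h3 := mul_lt_mul_of_neg_right h hα'
  have h4 : (f z + β / α * (b - g z)) * α = f z * α + (b - g z) * β := by
    linear_combination (b - g z) * h2
  linarith

/-- Strong duality, with attainment on both sides, for the transport problem with one prescribed
marginal and a bound on the total transport cost. -/
theorem exists_primal_dual_eq {G : Type*} [Fintype G] [Nonempty G] (π m : G → ℝ)
    (hπ : ∀ g, 0 ≤ π g) (c : G → G → ℝ) (hc : ∀ u, c u u = 0) {b : ℝ} (hb : 0 < b) :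
    ∃ p : ℝ,
      ((∃ Γ : G → G → ℝ,
          ((∀ u v, 0 ≤ Γ u v) ∧ (∀ u, ∑ v, Γ u v = π u) ∧ ∑ u, ∑ v, Γ u v * c u v ≤ b) ∧
          ∑ u, ∑ v, Γ u v * m v = p) ∧
        (∀ Γ : G → G → ℝ,
          ((∀ u v, 0 ≤ Γ u v) ∧ (∀ u, ∑ v, Γ u v = π u) ∧ ∑ u, ∑ v, Γ u v * c u v ≤ b) →
          ∑ u, ∑ v, Γ u v * m v ≤ p)) ∧
      ((∃ lam : ℝ, 0 ≤ lam ∧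
          lam * b + ∑ u, (univ.sup' univ_nonempty (fun v => m v - lam * c u v)) * π u = p) ∧
        (∀ lam : ℝ, 0 ≤ lam →
          p ≤ lam * b + ∑ u, (univ.sup' univ_nonempty (fun v => m v - lam * c u v)) * π u)) := by
  classical
  let K : Set (G → G → ℝ) := {Γ | (∀ u v, 0 ≤ Γ u v) ∧ ∀ u, ∑ v, Γ u v = π u}
  have hKconv : Convex ℝ K := by
    rintro Γ ⟨h1, h2⟩ Δ ⟨h3, h4⟩ s t hs ht hst
    refine ⟨fun u v => ?_, fun u => ?_⟩
    · have := h1 u v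
      have := h3 u v
      simp only [Pi.add_apply, Pi.smul_apply, smul_eq_mul]
      positivity
    · simp only [Pi.add_apply, Pi.smul_apply, smul_eq_mul, sum_add_distrib, ← mul_sum, h2, h4]
      rw [← add_mul, hst, one_mul]
  let L (a : G → G → ℝ) : (G → G → ℝ) →ₗ[ℝ] ℝ :=
    { toFun := fun Γ => ∑ u, ∑ v, Γ u v * a u v
      map_add' := fun Γ Δ => by simp [add_mul, sum_add_distrib]
      map_smul' := fun r Γ => by simp [mul_sum, mul_assoc] }
  have hLcont (a : G → G → ℝ) : Continuous fun Γ : G → G → ℝ => ∑ u, ∑ v, Γ u v * a u v := by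
    fun_prop
  have point (k : G → G) : (fun u v => if v = k u then π u else 0) ∈ K :=
    ⟨fun u v => by dsimp only; split_ifs <;> simp [hπ], fun u => by simp⟩
  have hdiag : L c (fun u v => if v = u then π u else 0) = 0 := by simp [L, hc]
  let F : Set (G → G → ℝ) := K ∩ {Γ | L c Γ ≤ b}
  have hFcomp : IsCompact F := by
    have hbox : IsCompact (Set.univ.pi fun u : G => Set.univ.pi fun _ : G => Set.Icc 0 (π u)) :=
      isCompact_univ_pi fun u => isCompact_univ_pi fun _ => isCompact_Icc
    refine hbox.of_isClosed_subset ?_ ?_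
    · have hnonneg : IsClosed {Γ : G → G → ℝ | ∀ u v, 0 ≤ Γ u v} := by
        simp only [Set.ofPred_forall]
        exact isClosed_iInter fun u => isClosed_iInter fun v =>
          isClosed_le continuous_const (by fun_prop)
      have hmarg : IsClosed {Γ : G → G → ℝ | ∀ u, ∑ v, Γ u v = π u} := by
        simp only [Set.ofPred_forall]
        exact isClosed_iInter fun u => isClosed_eq (by fun_prop) continuous_const
      exact (hnonneg.inter hmarg).inter (isClosed_le (hLcont c) continuous_const)
    · rintro Γ ⟨⟨h1, h2⟩, -⟩ u - v -
      exact ⟨h1 u v, h2 u ▸ single_le_sum (f := Γ u) (fun v _ => h1 u v) (mem_univ v)⟩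
  obtain ⟨Γ, hΓ, hmax⟩ := hFcomp.exists_isMaxOn
    ⟨_, point id, (hdiag.trans_le hb.le : L c _ ≤ b)⟩ (hLcont fun _ v => m v).continuousOn
  have hmax' : ∀ Δ ∈ K, L c Δ ≤ b → L (fun _ v => m v) Δ ≤ L (fun _ v => m v) Γ :=
    fun Δ h1 h2 => hmax ⟨h1, h2⟩
  have hweak : ∀ lam : ℝ, 0 ≤ lam → L (fun _ v => m v) Γ ≤
      lam * b + ∑ u, (univ.sup' univ_nonempty (fun v => m v - lam * c u v)) * π u := by
    intro lam hlam
    have hcost : lam * L c Γ ≤ lam * b := mul_le_mul_of_nonneg_left hΓ.2 hlam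
    have hrow : ∑ u, ∑ v, Γ u v * (m v - lam * c u v) ≤
        ∑ u, (univ.sup' univ_nonempty (fun v => m v - lam * c u v)) * π u := by
      refine sum_le_sum fun u _ => ?_
      rw [← hΓ.1.2 u, mul_sum]
      refine sum_le_sum fun v _ => ?_
      rw [mul_comm]
      exact mul_le_mul_of_nonneg_right
        (le_sup' (fun v => m v - lam * c u v) (mem_univ v)) (hΓ.1.1 u v)
    have hsplit : ∑ u, ∑ v, Γ u v * (m v - lam * c u v) =
        L (fun _ v => m v) Γ - lam * L c Γ := by
      simp only [L, LinearMap.coe_mk, AddHom.coe_mk, mul_sum, ← sum_sub_distrib]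
      exact sum_congr rfl fun u _ => sum_congr rfl fun v _ => by ring
    linarith
  obtain ⟨lam, hlam, hdual⟩ := exists_lagrange_multiplier hKconv (L fun _ v => m v) (L c) hmax'
    (point id) (hdiag.trans_lt hb)
  have hsel : ∀ u, ∃ k, univ.sup' univ_nonempty (fun v => m v - lam * c u v) =
      m k - lam * c u k := fun u => by
    obtain ⟨k, -, hk⟩ := exists_mem_eq_sup' univ_nonempty (fun v => m v - lam * c u v)
    exact ⟨k, hk⟩
  choose k hk using hsel
  refine ⟨L (fun _ v => m v) Γ, ⟨⟨Γ, ⟨hΓ.1.1, hΓ.1.2, hΓ.2⟩, rfl⟩,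
    fun Δ hΔ => hmax' Δ ⟨hΔ.1, hΔ.2.1⟩ hΔ.2.2⟩, ⟨lam, hlam, le_antisymm ?_ (hweak lam hlam)⟩, hweak⟩
  refine le_of_eq_of_le ?_ (hdual _ (point k))
  have hL (a : G → G → ℝ) : L a (fun u v => if v = k u then π u else 0) =
      ∑ u, π u * a u (k u) := by simp [L]
  rw [hL, hL, mul_sub, mul_sum, add_sub_left_comm, ← sum_sub_distrib]
  simp only [hk]
  congr 1
  exact sum_congr rfl fun u _ => by ring


/-- **Strong duality for the Wasserstein linear program (Proposition 1).**
`𝒢` is a nonempty finite set of nonnegative integers (a nonempty finite type `G`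
with an injection `val : G → ℕ`), `𝒳` a nonempty finite set, `π*_x` a probability
vector on `𝒢` for each `x`, and `m(·,x) : 𝒢 → ℝ`.  For `q ∈ [1,∞)` and `δ > 0`, the
primal value `κ̄_{δ,q} = ∑_x max_{Γ ∈ F(π*_x,δ,q)} ∑_{u,v} Γ(u,v) m(v,x)` equals the
dual value `∑_x min_{λ ≥ 0} [λ δ^q + ∑_u (max_v (m(v,x) − λ|u−v|^q)) π*_x(u)]`, where
for each `x` both the inner maximum and the inner minimum are attained. -/
theorem stmt_0
    (G : Type) [Fintype G] [Nonempty G] (val : G → ℕ) (hval : Function.Injective val)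
    (X : Type) [Fintype X] [Nonempty X]
    (πstar : X → G → ℝ)
    (hπ : ∀ x, (∀ g, 0 ≤ πstar x g) ∧ ∑ g, πstar x g = 1)
    (m : G → X → ℝ) (q δ : ℝ) (hq : 1 ≤ q) (hδ : 0 < δ) :
    ∃ primal dual : X → ℝ,
      -- for each x, the inner maximum over Γ ∈ F(π*_x, δ, q) is attained at value `primal x`
      (∀ x : X,
        (∃ Γ : G → G → ℝ,
          ((∀ u v, 0 ≤ Γ u v) ∧ (∀ u, ∑ v, Γ u v = πstar x u) ∧
            ∑ u, ∑ v, Γ u v * |(val u : ℝ) - (val v : ℝ)| ^ q ≤ δ ^ q) ∧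
          ∑ u, ∑ v, Γ u v * m v x = primal x) ∧
        (∀ Γ : G → G → ℝ,
          ((∀ u v, 0 ≤ Γ u v) ∧ (∀ u, ∑ v, Γ u v = πstar x u) ∧
            ∑ u, ∑ v, Γ u v * |(val u : ℝ) - (val v : ℝ)| ^ q ≤ δ ^ q) →
          ∑ u, ∑ v, Γ u v * m v x ≤ primal x)) ∧
      -- for each x, the minimum over λ ≥ 0 of the dual objective is attained at value `dual x`
      (∀ x : X,
        (∃ lam : ℝ, 0 ≤ lam ∧
          lam * δ ^ q + ∑ u, (Finset.univ.sup' Finset.univ_nonempty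
            (fun v => m v x - lam * |(val u : ℝ) - (val v : ℝ)| ^ q)) * πstar x u = dual x) ∧
        (∀ lam : ℝ, 0 ≤ lam →
          dual x ≤ lam * δ ^ q + ∑ u, (Finset.univ.sup' Finset.univ_nonempty
            (fun v => m v x - lam * |(val u : ℝ) - (val v : ℝ)| ^ q)) * πstar x u)) ∧
      -- strong duality
      ∑ x, primal x = ∑ x, dual x := by
  choose p h using fun x => exists_primal_dual_eq (πstar x) (fun v => m v x) (hπ x).1
    (fun u v => |(val u : ℝ) - (val v : ℝ)| ^ q)
    (fun u => by simp [Real.zero_rpow (by linarith : q ≠ 0)]) (Real.rpow_pos_of_pos hδ q)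
  exact ⟨p, p, fun x => (h x).1, fun x => (h x).2, rfl⟩
end

section
/- Hadamard directional differentiability of the linear-program value (key lemma in the proof of Theorem 1): let 𝒢 be a nonempty finite set, B a nonempty compact subset of ℝ^{𝒢×𝒢}, and for f : 𝒢 → ℝ define ⟨Γ, f⟩ := ∑_{u,v∈𝒢} Γ(u,v) f(v), φ(f) := max_{Γ∈B} ⟨Γ, f⟩, and S*(f) := {Γ ∈ B : ⟨Γ, f⟩ = φ(f)}. Then for every f, h : 𝒢 → ℝ and every family (h_t)_{t>0} of functions 𝒢 → ℝ with h_t → h as t ↓ 0, one has lim_{t↓0} (φ(f + t h_t) − φ(f)) / t = max_{Γ ∈ S*(f)} ⟨Γ, h⟩. -/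
open Filter Topology

/-- The pairing `⟨Γ, f⟩ = ∑_{u,v} Γ(u,v) f(v)`. -/
noncomputable def pairing {G : Type} [Fintype G] (Γ : G × G → ℝ) (f : G → ℝ) : ℝ :=
  ∑ p : G × G, Γ p * f p.2

/-- The linear-program value `φ(f) = max_{Γ ∈ B} ⟨Γ, f⟩`. -/
noncomputable def lpValue {G : Type} [Fintype G] (B : Set (G × G → ℝ)) (f : G → ℝ) : ℝ :=
  sSup ((fun Γ => pairing Γ f) '' B)

/-- The argmax set `S*(f) = {Γ ∈ B : ⟨Γ, f⟩ = φ(f)}`. -/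
def argmaxSet {G : Type} [Fintype G] (B : Set (G × G → ℝ)) (f : G → ℝ) :
    Set (G × G → ℝ) :=
  {Γ ∈ B | pairing Γ f = lpValue B f}

theorem continuous_pairing {G : Type} [Fintype G] :
    Continuous fun q : (G × G → ℝ) × (G → ℝ) => pairing q.1 q.2 := by
  unfold pairing
  fun_prop

theorem pairing_add_mul {G : Type} [Fintype G] (Γ : G × G → ℝ) (f g : G → ℝ) (t : ℝ) :
    pairing Γ (fun v => f v + t * g v) = pairing Γ f + t * pairing Γ g := by
  simp only [pairing, Finset.mul_sum, ← Finset.sum_add_distrib]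
  exact Finset.sum_congr rfl fun p _ => by ring

theorem pairing_le_lpValue {G : Type} [Fintype G] {B : Set (G × G → ℝ)} (hB : IsCompact B)
    {Γ : G × G → ℝ} (hΓ : Γ ∈ B) (f : G → ℝ) : pairing Γ f ≤ lpValue B f :=
  le_csSup (hB.image (continuous_pairing.comp (Continuous.prodMk_left f))).bddAbove ⟨Γ, hΓ, rfl⟩

theorem lpValue_le {G : Type} [Fintype G] {B : Set (G × G → ℝ)} (hB : B.Nonempty)
    {f : G → ℝ} {c : ℝ} (hc : ∀ Γ ∈ B, pairing Γ f ≤ c) : lpValue B f ≤ c :=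
  csSup_le (hB.image _) (Set.forall_mem_image.2 hc)

theorem argmaxSet_nonempty {G : Type} [Fintype G] {B : Set (G × G → ℝ)} (hB : IsCompact B)
    (hne : B.Nonempty) (f : G → ℝ) : (argmaxSet B f).Nonempty :=
  (hB.image (continuous_pairing.comp (Continuous.prodMk_left f))).sSup_mem (hne.image _)

theorem isCompact_argmaxSet {G : Type} [Fintype G] {B : Set (G × G → ℝ)} (hB : IsCompact B)
    (f : G → ℝ) : IsCompact (argmaxSet B f) :=
  hB.inter_right <| isClosed_singleton.preimage
    (continuous_pairing.comp (Continuous.prodMk_left f))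

/-- A strict upper bound on `⟨Γ, h⟩` over the argmax set at `f` bounds the growth of
`⟨Γ, f + t h_t⟩` above `φ(f)` uniformly over `B` for small `t > 0`. -/
theorem eventually_forall_pairing_le {G : Type} [Fintype G] {B : Set (G × G → ℝ)}
    (hB : IsCompact B) {f h : G → ℝ} {ht : ℝ → G → ℝ}
    (hconv : Tendsto ht (𝓝[>] (0 : ℝ)) (𝓝 h)) {c : ℝ}
    (hc : ∀ Γ ∈ argmaxSet B f, pairing Γ h < c) :
    ∀ᶠ t in 𝓝[>] (0 : ℝ), ∀ Γ ∈ B, pairing Γ f + t * pairing Γ (ht t) ≤ lpValue B f + t * c := by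
  refine hB.induction_on
    (p := fun s => ∀ᶠ t in 𝓝[>] (0 : ℝ), ∀ Γ ∈ s,
      pairing Γ f + t * pairing Γ (ht t) ≤ lpValue B f + t * c)
    (by simp) (fun s u hsu hu => hu.mono fun t H Γ hΓ => H Γ (hsu hΓ))
    (fun s u hs hu => by
      filter_upwards [hs, hu] with t h₁ h₂ Γ hΓ using hΓ.elim (h₁ Γ) (h₂ Γ)) fun Γ hΓ => ?_
  suffices H : ∀ᶠ q : (G × G → ℝ) × ℝ in 𝓝[B] Γ ×ˢ 𝓝[>] (0 : ℝ),
      pairing q.1 f + q.2 * pairing q.1 (ht q.2) ≤ lpValue B f + q.2 * c by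
    obtain ⟨P, hP, Q, hQ, hPQ⟩ := eventually_prod_iff.1 H
    exact ⟨{Γ' | P Γ'}, hP, hQ.mono fun t hQt Γ' hΓ' => hPQ hΓ' hQt⟩
  have hfst : Tendsto Prod.fst (𝓝[B] Γ ×ˢ 𝓝[>] (0 : ℝ)) (𝓝 Γ) :=
    tendsto_fst.mono_right nhdsWithin_le_nhds
  have hsnd : Tendsto Prod.snd (𝓝[B] Γ ×ˢ 𝓝[>] (0 : ℝ)) (𝓝 0) :=
    tendsto_snd.mono_right nhdsWithin_le_nhds
  have hlim : Tendsto (fun q : (G × G → ℝ) × ℝ => pairing q.1 (ht q.2))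
      (𝓝[B] Γ ×ˢ 𝓝[>] (0 : ℝ)) (𝓝 (pairing Γ h)) :=
    (continuous_pairing.tendsto (Γ, h)).comp (hfst.prodMk_nhds (hconv.comp tendsto_snd))
  by_cases hmax : pairing Γ f = lpValue B f
  · filter_upwards [hlim.eventually_lt_const (hc Γ ⟨hΓ, hmax⟩),
      tendsto_fst.eventually (eventually_mem_nhdsWithin (a := Γ) (s := B)),
      tendsto_snd.eventually (eventually_mem_nhdsWithin (a := (0 : ℝ)) (s := Set.Ioi 0))]
      with q hq hqB hq0
    exact add_le_add (pairing_le_lpValue hB hqB f) (mul_le_mul_of_nonneg_left hq.le hq0.le)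
  · have hf : Tendsto (fun q : (G × G → ℝ) × ℝ => pairing q.1 f)
        (𝓝[B] Γ ×ˢ 𝓝[>] (0 : ℝ)) (𝓝 (pairing Γ f)) :=
      (continuous_pairing.tendsto (Γ, f)).comp (hfst.prodMk_nhds tendsto_const_nhds)
    refine ((hf.add (hsnd.mul hlim)).eventually_lt
      (tendsto_const_nhds.add (hsnd.mul_const c)) ?_).mono fun q hq => hq.le
    simpa using (pairing_le_lpValue hB hΓ f).lt_of_ne hmax

/-- **Hadamard directional differentiability of the linear-program value.**
Let `𝒢` be a nonempty finite set, `B` a nonempty compact subset of `ℝ^{𝒢×𝒢}`.  For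
every `f, h : 𝒢 → ℝ` and every family `(h_t)_{t>0}` with `h_t → h` as `t ↓ 0`,
`lim_{t↓0} (φ(f + t h_t) − φ(f))/t = max_{Γ ∈ S*(f)} ⟨Γ, h⟩` (the maximum on the
right-hand side being attained). -/
theorem stmt_2
    (G : Type) [Fintype G] [Nonempty G]
    (B : Set (G × G → ℝ)) (hBne : B.Nonempty) (hBcomp : IsCompact B)
    (f h : G → ℝ) (ht : ℝ → G → ℝ)
    (hconv : Tendsto ht (𝓝[>] (0 : ℝ)) (𝓝 h)) :
    ∃ M : ℝ,
      IsGreatest ((fun Γ => pairing Γ h) '' argmaxSet B f) M ∧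
      Tendsto (fun t : ℝ => (lpValue B (fun v => f v + t * ht t v) - lpValue B f) / t)
        (𝓝[>] (0 : ℝ)) (𝓝 M) := by
  obtain ⟨M, hM⟩ := ((isCompact_argmaxSet hBcomp f).image
    (continuous_pairing.comp (Continuous.prodMk_left h))).exists_isGreatest
    ((argmaxSet_nonempty hBcomp hBne f).image _)
  refine ⟨M, hM, tendsto_order.2 ⟨fun a ha => ?_, fun a ha => ?_⟩⟩
  · obtain ⟨Γ, ⟨hΓB, hΓf⟩, rfl⟩ := hM.1
    have hlim : Tendsto (fun t => pairing Γ (ht t)) (𝓝[>] (0 : ℝ)) (𝓝 (pairing Γ h)) :=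
      (continuous_pairing.tendsto (Γ, h)).comp (tendsto_const_nhds.prodMk_nhds hconv)
    filter_upwards [hlim.eventually_const_lt ha, self_mem_nhdsWithin] with t hta ht0
    refine hta.trans_le ((le_div_iff₀ ht0).2 ?_)
    have := pairing_le_lpValue hBcomp hΓB fun v => f v + t * ht t v
    rw [pairing_add_mul] at this
    linarith
  · obtain ⟨c, hMc, hca⟩ := exists_between ha
    filter_upwards [eventually_forall_pairing_le hBcomp hconv
      fun Γ hΓ => (hM.2 ⟨Γ, hΓ, rfl⟩).trans_lt hMc, self_mem_nhdsWithin] with t htB ht0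
    refine ((div_le_iff₀ ht0).2 ?_).trans_lt hca
    have := lpValue_le (f := fun v => f v + t * ht t v) hBne
      fun Γ hΓ => (pairing_add_mul Γ f (ht t) t).trans_le (htB Γ hΓ)
    linarith
end

section
/- Dual computation in the two-point example (Appendix A.2): let m(0) ≤ m(1) be real numbers, α* ∈ [0,1], δ > 0, and define D(λ) := λ δ + max{ m(0) − λ, m(1) }·α* + max{ m(0), m(1) − λ }·(1 − α*) for λ ≥ 0. Then inf_{λ ≥ 0} D(λ) = m(0) + min{1, α* + δ}·(m(1) − m(0)), and the infimum is attained (at λ = 0 if δ ≥ 1 − α*, and at λ = m(1) − m(0) if δ < 1 − α*). -/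
/-- **Dual computation in the two-point example (Appendix A.2).**  Let
`m(0) ≤ m(1)`, `α* ∈ [0,1]`, `δ > 0`, and
`D(λ) = λδ + max{m(0) − λ, m(1)}·α* + max{m(0), m(1) − λ}·(1 − α*)` for `λ ≥ 0`.
Then `inf_{λ ≥ 0} D(λ) = m(0) + min{1, α* + δ}·(m(1) − m(0))`, the infimum being
attained (at `λ = 0` if `δ ≥ 1 − α*`, and at `λ = m(1) − m(0)` if `δ < 1 − α*`). -/
theorem stmt_12
    (m0 m1 αstar δ : ℝ) (hm : m0 ≤ m1)
    (hαstar : αstar ∈ Set.Icc (0 : ℝ) 1) (hδ : 0 < δ) :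
    IsLeast
      ((fun lam : ℝ =>
          lam * δ + max (m0 - lam) m1 * αstar + max m0 (m1 - lam) * (1 - αstar)) ''
        Set.Ici (0 : ℝ))
      (m0 + min 1 (αstar + δ) * (m1 - m0)) ∧
    (1 - αstar ≤ δ →
      0 * δ + max (m0 - 0) m1 * αstar + max m0 (m1 - 0) * (1 - αstar) =
        m0 + min 1 (αstar + δ) * (m1 - m0)) ∧
    (δ < 1 - αstar →
      (m1 - m0) * δ + max (m0 - (m1 - m0)) m1 * αstar +
          max m0 (m1 - (m1 - m0)) * (1 - αstar) =
        m0 + min 1 (αstar + δ) * (m1 - m0)) := by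
  obtain ⟨-, hα⟩ := hαstar
  have at_zero : 1 - αstar ≤ δ →
      0 * δ + max (m0 - 0) m1 * αstar + max m0 (m1 - 0) * (1 - αstar) =
        m0 + min 1 (αstar + δ) * (m1 - m0) := by
    intro h
    rw [min_eq_left (by linarith), max_eq_right (by linarith), max_eq_right (by linarith)]
    ring
  have at_gap : δ < 1 - αstar →
      (m1 - m0) * δ + max (m0 - (m1 - m0)) m1 * αstar +
          max m0 (m1 - (m1 - m0)) * (1 - αstar) =
        m0 + min 1 (αstar + δ) * (m1 - m0) := by
    intro h
    rw [min_eq_right (by linarith), max_eq_right (by linarith), max_eq_left (by linarith)]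
    ring
  refine ⟨⟨?_, ?_⟩, at_zero, at_gap⟩
  · rcases le_or_gt (1 - αstar) δ with h | h
    · exact ⟨0, Set.self_mem_Ici, at_zero h⟩
    · exact ⟨m1 - m0, sub_nonneg.2 hm, at_gap h⟩
  · rintro _ ⟨lam, hlam, rfl⟩
    rw [Set.mem_Ici] at hlam
    dsimp only
    rw [max_eq_right (by linarith : m0 - lam ≤ m1)]
    rcases le_total (1 - αstar) δ with h | h
    · rw [min_eq_left (by linarith)]
      have hmax := mul_le_mul_of_nonneg_right (le_max_right m0 (m1 - lam)) (sub_nonneg.2 hα)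
      linarith [mul_nonneg hlam (sub_nonneg.2 h)]
    · rw [min_eq_right (by linarith)]
      rcases le_total lam (m1 - m0) with hl | hl
      · rw [max_eq_right (by linarith : m0 ≤ m1 - lam)]
        linarith [mul_nonneg (sub_nonneg.2 hl) (sub_nonneg.2 h)]
      · rw [max_eq_left (by linarith : m1 - lam ≤ m0)]
        linarith [mul_nonneg (sub_nonneg.2 hl) hδ.le]
end
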